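/- Let N and n be positive integers and let f : ℝ^N → ℝ be a twice continuously differentiable nonnegative function satisfying Δf(x) ≥ (3/n)·f(x)² − (n+3)·f(x) for every x ∈ ℝ^N. Then f(x) ≤ n(n+3)/3 for every x ∈ ℝ^N. -/

import Mathlib

/-- The Euclidean Laplacian of a function `f : ℝ^N → ℝ`:
`Δf(x) = ∑ i, ∂²f/∂x_i²(x)`. -/
noncomputable def euclideanLaplacian {N : ℕ} (f : EuclideanSpace ℝ (Fin N) → ℝ)
    (x : EuclideanSpace ℝ (Fin N)) : ℝ :=
  ∑ i : Fin N, iteratedFDeriv ℝ 2 f x ![EuclideanSpace.single i 1, EuclideanSpace.single i 1]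

open Filter Topology

/-- The second derivative is nonpositive at a local maximum. -/
lemma IsLocalMax.second_deriv_nonpos {h h₁ : ℝ → ℝ} {h₂ t : ℝ} (hmax : IsLocalMax h t)
    (hd : ∀ s, HasDerivAt h (h₁ s) s) (hd₁ : HasDerivAt h₁ h₂ t) : h₂ ≤ 0 := by
  by_contra! hpos
  have hderiv : deriv h = h₁ := funext fun s => (hd s).deriv
  have hmin : IsLocalMin h t := by
    apply isLocalMin_of_deriv_deriv_pos
    · rwa [hderiv, hd₁.deriv]
    · exact hmax.deriv_eq_zero
    · exact (hd t).continuousAt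
  have hconst : h =ᶠ[𝓝 t] fun _ => h t := by
    filter_upwards [hmax, hmin] with s hs hs' using le_antisymm hs hs'
  have hzero : h₁ =ᶠ[𝓝 t] fun _ => 0 := by
    simpa [hderiv] using hconst.deriv
  have := hzero.deriv_eq
  rw [hd₁.deriv, deriv_const] at this
  exact hpos.ne' this

/-- Second order condition for a local maximum of `g` times the square of a concave quadratic. -/
lemma second_deriv_le_of_isLocalMax_mul_sq {g g₁ : ℝ → ℝ} {g₂ a b : ℝ} (ha : 0 < a)
    (hd : ∀ s, HasDerivAt g (g₁ s) s) (hd₁ : HasDerivAt g₁ g₂ 0)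
    (hmax : IsLocalMax (fun t => g t * (a - 2 * b * t - t ^ 2) ^ 2) 0) :
    g₂ * a ^ 2 ≤ g 0 * (24 * b ^ 2 + 4 * a) := by
  have hq : ∀ s, HasDerivAt (fun t : ℝ => a - 2 * b * t - t ^ 2) (-2 * b - 2 * s) s := fun s => by
    exact ((((hasDerivAt_id s).const_mul (2 * b)).const_sub a).sub
      ((hasDerivAt_id s).pow 2)).congr_deriv (by simp)
  have hq₁ : HasDerivAt (fun s : ℝ => -2 * b - 2 * s) (-2) 0 := by
    exact (((hasDerivAt_id (0 : ℝ)).const_mul 2).const_sub (-2 * b)).congr_deriv (by simp)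
  have hh := fun s => (hd s).mul ((hq s).pow 2)
  have hh₁ := (hd₁.mul ((hq 0).pow 2)).add
    ((hd 0).mul (((hq 0).const_mul 2).mul hq₁))
  have hfirst := hmax.hasDerivAt_eq_zero (hh 0)
  have hsecond := hmax.second_deriv_nonpos
    (h₁ := fun s => g₁ s * (a - 2 * b * s - s ^ 2) ^ 2 +
      g s * (2 * (a - 2 * b * s - s ^ 2) * (-2 * b - 2 * s)))
    (fun s => (hh s).congr_deriv (by simp)) hh₁
  simp at hfirst hsecond
  have hg₁ : g₁ 0 * a = 4 * g 0 * b := by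
    apply mul_right_cancel₀ ha.ne'
    linear_combination hfirst
  have hcross : g₁ 0 * a * b = 4 * g 0 * b * b := by rw [hg₁]
  linarith

/-- The second order condition along a line through a local maximum of
`(f - C) * (R² - |· - x|²)²`. -/
lemma iteratedFDeriv_two_le_of_isLocalMax {E : Type*} [NormedAddCommGroup E]
    [InnerProductSpace ℝ E] {f : E → ℝ} (hf : ContDiff ℝ 2 f) {C R : ℝ} {x y e : E}
    (he : ‖e‖ = 1) (hy : 0 < R ^ 2 - ‖y - x‖ ^ 2)
    (hmax : IsLocalMax (fun z => (f z - C) * (R ^ 2 - ‖z - x‖ ^ 2) ^ 2) y) :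
    iteratedFDeriv ℝ 2 f y ![e, e] * (R ^ 2 - ‖y - x‖ ^ 2) ^ 2 ≤
      (f y - C) * (24 * inner ℝ (y - x) e ^ 2 + 4 * (R ^ 2 - ‖y - x‖ ^ 2)) := by
  have hline : ∀ s : ℝ, HasDerivAt (fun t : ℝ => y + t • e) e s := fun s => by
    simpa using ((hasDerivAt_id s).smul_const e).const_add y
  have hfd : Differentiable ℝ f := hf.differentiable (by norm_num)
  have hfd' : Differentiable ℝ (fderiv ℝ f) :=
    (hf.fderiv_right (m := 1) (by norm_num)).differentiable (by norm_num)
  have hd : ∀ s : ℝ, HasDerivAt (fun t : ℝ => f (y + t • e) - C) (fderiv ℝ f (y + s • e) e) s :=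
    fun s => ((hfd _).hasFDerivAt.comp_hasDerivAt s (hline s)).sub_const C
  have hd₁ : HasDerivAt (fun s : ℝ => fderiv ℝ f (y + s • e) e)
      (iteratedFDeriv ℝ 2 f y ![e, e]) 0 := by
    have := ((hfd' _).hasFDerivAt.comp_hasDerivAt (0 : ℝ) (hline 0)).clm_apply
      (hasDerivAt_const (0 : ℝ) e)
    simpa [iteratedFDeriv_two_apply] using this
  have hcomp : IsLocalMax
      ((fun z => (f z - C) * (R ^ 2 - ‖z - x‖ ^ 2) ^ 2) ∘ fun t : ℝ => y + t • e) 0 :=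
    IsMaxFilter.comp_tendsto (l := 𝓝 y) (by simpa [IsLocalMax] using hmax)
      (by simpa using (hline 0).continuousAt.tendsto)
  have hnorm : ∀ t : ℝ, R ^ 2 - ‖y + t • e - x‖ ^ 2 =
      R ^ 2 - ‖y - x‖ ^ 2 - 2 * inner ℝ (y - x) e * t - t ^ 2 := fun t => by
    rw [add_sub_right_comm, norm_add_sq_real, inner_smul_right, norm_smul, he, mul_one,
      Real.norm_eq_abs, sq_abs]
    ring
  simpa using second_deriv_le_of_isLocalMax_mul_sq hy hd hd₁
    (by simpa only [Function.comp_def, hnorm] using hcomp)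

/-- Interior Keller–Osserman estimate on the ball of radius `R` about `x`. -/
lemma sub_mul_sq_le_of_le_euclideanLaplacian {N : ℕ} {f : EuclideanSpace ℝ (Fin N) → ℝ}
    (hf : ContDiff ℝ 2 f) {c C R : ℝ} (hc : 0 < c) (hR : 0 < R)
    (hineq : ∀ y, C < f y → c * (f y - C) ^ 2 ≤ euclideanLaplacian f y)
    (x : EuclideanSpace ℝ (Fin N)) : c * (f x - C) * R ^ 2 ≤ 24 + 4 * N := by
  rcases le_or_gt (f x) C with hx | hx
  · have : c * (f x - C) * R ^ 2 ≤ 0 :=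
      mul_nonpos_of_nonpos_of_nonneg
        (mul_nonpos_of_nonneg_of_nonpos hc.le (sub_nonpos.2 hx)) (sq_nonneg R)
    exact this.trans (by positivity)
  set h : EuclideanSpace ℝ (Fin N) → ℝ := fun z => (f z - C) * (R ^ 2 - ‖z - x‖ ^ 2) ^ 2 with hdef
  have hcont : Continuous h := by
    have := hf.continuous
    fun_prop
  obtain ⟨y, hyB, hymax⟩ := (isCompact_closedBall x R).exists_isMaxOn
    (Metric.nonempty_closedBall.2 hR.le) hcont.continuousOn
  have hxy : (f x - C) * (R ^ 2) ^ 2 ≤ h y := by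
    simpa [hdef] using hymax (Metric.mem_closedBall_self hR.le)
  have hypos : 0 < h y := lt_of_lt_of_le (by have := sub_pos.2 hx; positivity) hxy
  have hyR : ‖y - x‖ ≤ R := by simpa [dist_eq_norm] using hyB
  have hylt : ‖y - x‖ < R := by
    refine lt_of_le_of_ne hyR fun heq => hypos.ne' ?_
    simp [hdef, heq]
  have hφ : 0 < R ^ 2 - ‖y - x‖ ^ 2 := by
    have := pow_lt_pow_left₀ hylt (norm_nonneg _) two_ne_zero
    linarith
  have hu : 0 < f y - C := pos_of_mul_pos_left hypos (sq_nonneg _)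
  have hloc : IsLocalMax h y := hymax.isLocalMax
    (Metric.closedBall_mem_nhds_of_mem (by simpa [dist_eq_norm] using hylt))
  have hsum : euclideanLaplacian f y * (R ^ 2 - ‖y - x‖ ^ 2) ^ 2 ≤
      (f y - C) * (24 * ‖y - x‖ ^ 2 + 4 * N * (R ^ 2 - ‖y - x‖ ^ 2)) := by
    calc _ ≤ ∑ i : Fin N, (f y - C) *
          (24 * inner ℝ (y - x) (EuclideanSpace.single i 1) ^ 2 +
            4 * (R ^ 2 - ‖y - x‖ ^ 2)) := by
          rw [euclideanLaplacian, Finset.sum_mul]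
          exact Finset.sum_le_sum fun i _ =>
            iteratedFDeriv_two_le_of_isLocalMax hf (by simp) hφ hloc
      _ = _ := by
          rw [← Finset.mul_sum, Finset.sum_add_distrib, ← Finset.mul_sum,
            EuclideanSpace.real_norm_sq_eq (y - x)]
          simp [EuclideanSpace.inner_single_right]
          exact Or.inl (by ring)
  have hbound : c * h y ≤ (24 + 4 * N) * R ^ 2 := by
    have h₁ : c * (f y - C) ^ 2 * (R ^ 2 - ‖y - x‖ ^ 2) ^ 2 ≤
        (f y - C) * (24 * ‖y - x‖ ^ 2 + 4 * N * (R ^ 2 - ‖y - x‖ ^ 2)) :=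
      (mul_le_mul_of_nonneg_right (hineq y (sub_pos.1 hu)) (sq_nonneg _)).trans hsum
    have h₂ : c * h y ≤ 24 * ‖y - x‖ ^ 2 + 4 * N * (R ^ 2 - ‖y - x‖ ^ 2) := by
      refine le_of_mul_le_mul_left ?_ hu
      calc _ = c * (f y - C) ^ 2 * (R ^ 2 - ‖y - x‖ ^ 2) ^ 2 := by simp only [hdef]; ring
        _ ≤ _ := h₁
    have h₃ : 0 ≤ (N : ℝ) * ‖y - x‖ ^ 2 := by positivity
    linarith
  refine le_of_mul_le_mul_right ?_ (pow_pos hR 2)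
  calc c * (f x - C) * R ^ 2 * R ^ 2 = c * ((f x - C) * (R ^ 2) ^ 2) := by ring
    _ ≤ c * h y := mul_le_mul_of_nonneg_left hxy hc.le
    _ ≤ _ := hbound

/-- Euclidean form of the quantitative core of Theorem 2.1: if `f ≥ 0` is `C²` and
`Δf ≥ (3/n) f² − (n+3) f`, then `f ≤ n(n+3)/3`. -/
theorem stmt_4 {N n : ℕ} (hN : 0 < N) (hn : 0 < n)
    (f : EuclideanSpace ℝ (Fin N) → ℝ) (hf : ContDiff ℝ 2 f)
    (hf0 : ∀ x, 0 ≤ f x)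
    (hineq : ∀ x, (3 / (n : ℝ)) * f x ^ 2 - ((n : ℝ) + 3) * f x ≤ euclideanLaplacian f x) :
    ∀ x, f x ≤ (n : ℝ) * ((n : ℝ) + 3) / 3 := by
  intro x
  have hn' : (0 : ℝ) < n := Nat.cast_pos.2 hn
  set C : ℝ := (n : ℝ) * ((n : ℝ) + 3) / 3 with hC
  have hCpos : 0 ≤ C := by positivity
  have hsuper : ∀ y, C < f y → 3 / (n : ℝ) * (f y - C) ^ 2 ≤ euclideanLaplacian f y :=
    fun y hy => by
      refine le_trans ?_ (hineq y)
      have hcoef : (n : ℝ) + 3 = 3 / n * C := by rw [hC]; field_simp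
      have hdiff : 0 ≤ 3 / (n : ℝ) * (C * (f y - C)) :=
        mul_nonneg (by positivity) (mul_nonneg hCpos (sub_nonneg.2 hy.le))
      rw [hcoef]
      linarith
  by_contra! hx
  have hpos : 0 < 3 / (n : ℝ) * (f x - C) := mul_pos (by positivity) (sub_pos.2 hx)
  obtain ⟨R, hRpos, hR⟩ := ((eventually_gt_atTop (0 : ℝ)).and
    (((tendsto_pow_atTop two_ne_zero).const_mul_atTop hpos).eventually_gt_atTop
      (24 + 4 * (N : ℝ)))).exists
  exact hR.not_ge (sub_mul_sq_le_of_le_euclideanLaplacian hf (by positivity) hRpos hsuper x)
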